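/- For bond percolation on the two-dimensional torus T²_N, for every N ≥ 1 and every p ∈ [0,1], ℙ_p(A^□) = 1 − ℙ_{1−p}(S^□). -/

import Mathlib

/-!
Bond percolation on the torus `T^d_N`.  A configuration assigns `true`/`false`
(open/closed) to each edge of the graph on `(ℤ/Nℤ)^d` in which a vertex is joined
to its translates by standard basis vectors; edges are indexed by a vertex together
with a direction.  A configuration lifts `N`-periodically to `ℤ^d`, and the
giant-cycle event `A^□` asks for two distinct points of `ℤ^d`, congruent mod `N`,
joined by a path of open edges of the periodic lift.
-/

namespace TorusPerc

/-- The standard basis vector `e i` of `ℤ^d`. -/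
def stdVec (d : ℕ) (i : Fin d) : Fin d → ℤ := fun j => if j = i then 1 else 0

/-- An edge of the cubical torus: a vertex of `(ℤ/Nℤ)^d` together with a direction. -/
abbrev Edge (d N : ℕ) := (Fin d → ZMod N) × Fin d

/-- A bond configuration on the torus. -/
abbrev Config (d N : ℕ) := Edge d N → Bool

/-- Reduction of a point of `ℤ^d` modulo `N`. -/
def proj (d N : ℕ) (x : Fin d → ℤ) : Fin d → ZMod N := fun i => (x i : ZMod N)

/-- The edge of the periodic lift going from `x` in direction `i` is open. -/
def liftOpen (d N : ℕ) (ω : Config d N) (x : Fin d → ℤ) (i : Fin d) : Prop :=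
  ω (proj d N x, i) = true

/-- One step along an open edge of the periodic lift. -/
def step (d N : ℕ) (ω : Config d N) (x y : Fin d → ℤ) : Prop :=
  (∃ i, y = x + stdVec d i ∧ liftOpen d N ω x i) ∨
  (∃ i, x = y + stdVec d i ∧ liftOpen d N ω y i)

/-- Connectivity by paths of open edges in the periodic lift. -/
def connected (d N : ℕ) (ω : Config d N) : (Fin d → ℤ) → (Fin d → ℤ) → Prop :=
  Relation.ReflTransGen (step d N ω)

/-- The giant-cycle event `A^□`: some two distinct points of `ℤ^d` which are congruent
modulo `N` are joined by an open path of the periodic lift. -/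
def giantEvent (d N : ℕ) : Set (Config d N) :=
  {ω | ∃ x y : Fin d → ℤ, x ≠ y ∧ proj d N x = proj d N y ∧ connected d N ω x y}

/-- The set of winding vectors realized by a configuration. -/
def winding (d N : ℕ) (ω : Config d N) : Set (Fin d → ℤ) :=
  {w | ∃ x : Fin d → ℤ, connected d N ω x (x + (N : ℤ) • w)}

/-- The realized winding vectors, regarded as vectors in `ℚ^d`. -/
def windingQ (d N : ℕ) (ω : Config d N) : Set (Fin d → ℚ) :=
  (fun w : Fin d → ℤ => fun i => (w i : ℚ)) '' winding d N ω

/-- The spanning event `S^□`: the realized winding vectors span `ℚ^d`. -/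
def spanEvent (d N : ℕ) : Set (Config d N) :=
  {ω | Submodule.span ℚ (windingQ d N ω) = ⊤}

/-- The probability of an event under Bernoulli(`p`) bond percolation on the torus:
each edge is open independently with probability `p`. -/
noncomputable def prob (d N : ℕ) (p : ℝ) (S : Set (Config d N)) : ℝ :=
  ∑ᶠ ω ∈ S, ∏ᶠ e : Edge d N, (if ω e then p else 1 - p)

end TorusPerc


namespace TorusPerc

section aux
variable {d N : ℕ}

lemma proj_add (x y : Fin d → ℤ) : proj d N (x + y) = proj d N x + proj d N y := by
  funext i; simp [proj]

lemma proj_smul (w : Fin d → ℤ) : proj d N ((N : ℤ) • w) = 0 := by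
  funext i; simp [proj]

lemma proj_surj (t : Fin d → ZMod N) : ∃ x, proj d N x = t := by
  choose f hf using fun i => ZMod.intCast_surjective (t i)
  exact ⟨f, funext hf⟩

lemma proj_eq {x y : Fin d → ℤ} (h : proj d N x = proj d N y) :
    ∃ w : Fin d → ℤ, y = x + (N : ℤ) • w := by
  have : ∀ i, (N : ℤ) ∣ y i - x i := fun i =>
    (ZMod.intCast_eq_intCast_iff_dvd_sub _ _ _).1 (congrFun h i)
  choose w hw using this
  refine ⟨w, funext fun i => ?_⟩
  have := hw i
  simp only [Pi.add_apply, Pi.smul_apply, smul_eq_mul]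
  linarith

/-- unit vector on the torus -/
def u (d N : ℕ) (i : Fin d) : Fin d → ZMod N := proj d N (stdVec d i)

lemma step_symm {ω : Config d N} {x y} (h : step d N ω x y) : step d N ω y x := h.symm

lemma connected_symm {ω : Config d N} {x y} (h : connected d N ω x y) :
    connected d N ω y x := by
  induction h with
  | refl => exact .refl
  | tail _ hs ih => exact Relation.ReflTransGen.head (step_symm hs) ih

lemma step_translate {ω : Config d N} {x y} (h : step d N ω x y) (w : Fin d → ℤ) :
    step d N ω (x + (N : ℤ) • w) (y + (N : ℤ) • w) := by
  rcases h with ⟨i, rfl, h⟩ | ⟨i, rfl, h⟩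
  · refine .inl ⟨i, by abel, ?_⟩
    rwa [liftOpen, proj_add, proj_smul, add_zero]
  · refine .inr ⟨i, by abel, ?_⟩
    rwa [liftOpen, proj_add, proj_smul, add_zero]

lemma connected_translate {ω : Config d N} {x y} (h : connected d N ω x y)
    (w : Fin d → ℤ) : connected d N ω (x + (N : ℤ) • w) (y + (N : ℤ) • w) := by
  induction h with
  | refl => exact .refl
  | tail _ hs ih => exact ih.tail (step_translate hs w)

/-- connectivity on the torus -/
def torusSetoid (ω : Config d N) : Setoid (Fin d → ZMod N) where
  r t t' := ∃ x x', proj d N x = t ∧ proj d N x' = t' ∧ connected d N ω x x'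
  iseqv := by
    refine ⟨fun t => ?_, ?_, ?_⟩
    · obtain ⟨x, hx⟩ := proj_surj t
      exact ⟨x, x, hx, hx, .refl⟩
    · rintro t t' ⟨x, x', h, h', hc⟩
      exact ⟨x', x, h', h, connected_symm hc⟩
    · rintro t t' t'' ⟨x, x', h, h', hc⟩ ⟨y, y', k, k', kc⟩
      obtain ⟨w, rfl⟩ := proj_eq (k.trans h'.symm)
      exact ⟨x, y' + (N : ℤ) • w, h, by rw [proj_add, proj_smul, add_zero, k'],
        hc.trans (connected_translate kc w)⟩

lemma exists_section {M : Type*} [AddCommGroup M] (ω : Config d N) (L : (Fin d → ℤ) →+ M)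
    (hL : ∀ w ∈ winding d N ω, L ((N : ℤ) • w) = 0) :
    ∃ s : (Fin d → ZMod N) → M, ∀ t i, ω (t, i) = true →
      s (t + u d N i) = s t + L (stdVec d i) := by
  choose lft hlft using fun t : Fin d → ZMod N => proj_surj t
  let q : (Fin d → ZMod N) → Quotient (torusSetoid ω) := fun t => Quotient.mk _ t
  have key : ∀ t, ∃ x, proj d N x = t ∧ connected d N ω x (lft (q t).out) := by
    intro t
    obtain ⟨x, x', h, h', hc⟩ : (torusSetoid ω).r t (q t).out :=
      (torusSetoid ω).symm (Quotient.exact (Quotient.out_eq (q t)))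
    obtain ⟨w, hw⟩ := proj_eq (h'.trans (hlft (q t).out).symm)
    refine ⟨x + (N : ℤ) • w, by rw [proj_add, proj_smul, add_zero, h], ?_⟩
    rw [hw]
    exact connected_translate hc w
  choose s hs hsc using key
  refine ⟨fun t => L (s t), fun t i ho => ?_⟩
  have hst : step d N ω (s t) (s t + stdVec d i) := .inl ⟨i, rfl, by rw [liftOpen, hs]; exact ho⟩
  have hp : proj d N (s t + stdVec d i) = t + u d N i := by rw [proj_add, hs, u]
  have hq : q (t + u d N i) = q t := by
    apply Quotient.sound
    exact ⟨_, _, hp, hs t, .single (step_symm hst)⟩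
  have h1 := hsc (t + u d N i)
  rw [hq] at h1
  have h2 : connected d N ω (s t + stdVec d i) (s (t + u d N i)) :=
    ((Relation.ReflTransGen.single (step_symm hst)).trans (hsc t)).trans (connected_symm h1)
  obtain ⟨w, hw⟩ := proj_eq (hp.trans (hs (t + u d N i)).symm)
  have h3 := hL w ⟨_, hw ▸ h2⟩
  simp only
  rw [hw, map_add, map_add, h3, add_zero]

lemma walk_integral [NeZero N] (ω : Config d N) (φ : (Fin d → ZMod N) → Fin d → ℤ)
    (hcl : ∀ t i j, φ (t + u d N i) j - φ t j = φ (t + u d N j) i - φ t i)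
    (hz : ∀ t i, ω (t, i) = true → φ t i = 0) {x y} (h : connected d N ω x y) :
    ∃ I : (Fin d → ZMod N) → ℤ, I 0 = 0 ∧
      (∀ τ j, I (τ + u d N j) - I τ = φ (proj d N y + τ) j - φ (proj d N x + τ) j) ∧
      ∑ τ, I τ = ∑ j, (y j - x j) * ∑ t, φ t j := by
  induction h with
  | refl => exact ⟨0, by simp⟩
  | @tail y z _ hs ih =>
    obtain ⟨I, h0, h1, h2⟩ := ih
    rcases hs with ⟨i, rfl, ho⟩ | ⟨i, rfl, ho⟩
    · refine ⟨fun τ => I τ + φ (proj d N y + τ) i, ?_, ?_, ?_⟩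
      · simp [h0, hz _ _ ho]
      · intro τ j
        have a := h1 τ j
        have b := hcl (proj d N y + τ) i j
        rw [proj_add]
        change _ = φ (proj d N y + u d N i + τ) j - _
        beta_reduce
        rw [add_right_comm (proj d N y), ← add_assoc]
        linarith
      · rw [Finset.sum_add_distrib, h2,
          Fintype.sum_equiv (Equiv.addLeft (proj d N y)) (fun t => φ (proj d N y + t) i)
            (fun t => φ t i) (fun _ => rfl)]
        simp [stdVec, add_sub_right_comm, add_mul, Finset.sum_add_distrib]
    · refine ⟨fun τ => I τ - φ (proj d N z + τ) i, ?_, ?_, ?_⟩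
      · simp [h0, hz _ _ ho]
      · intro τ j
        have a := h1 τ j
        have b := hcl (proj d N z + τ) i j
        rw [proj_add] at a
        change _ = φ (proj d N z + u d N i + τ) j - _ at a
        rw [add_right_comm] at a
        beta_reduce
        rw [← add_assoc]
        linarith
      · rw [Finset.sum_sub_distrib, h2,
          Fintype.sum_equiv (Equiv.addLeft (proj d N z)) (fun t => φ (proj d N z + t) i)
            (fun t => φ t i) (fun _ => rfl)]
        simp [stdVec, add_sub_right_comm, add_mul, Finset.sum_add_distrib]

lemma const_of_inv (I : (Fin d → ZMod N) → ℤ) (h : ∀ τ j, I (τ + u d N j) = I τ) (τ) :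
    I τ = I 0 := by
  have h1 : ∀ (j : Fin d) (n : ℕ) τ, I (τ + n • u d N j) = I τ := by
    intro j n
    induction n with
    | zero => simp
    | succ n ih => intro τ; rw [succ_nsmul, ← add_assoc, h, ih]
  have h2 : ∀ (j : Fin d) (n : ℤ) τ, I (τ + n • u d N j) = I τ := by
    intro j n τ
    obtain ⟨m, rfl | rfl⟩ := n.eq_nat_or_neg
    · simpa using h1 j m τ
    · have := h1 j m (τ + (-(m : ℤ)) • u d N j)
      rw [← this]; congr 1
      simp
  obtain ⟨x, rfl⟩ := proj_surj τ
  have h3 : ∀ S : Finset (Fin d), I (∑ j ∈ S, x j • u d N j) = I 0 := by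
    intro S
    induction S using Finset.induction_on with
    | empty => simp
    | insert a S ha ih => rw [Finset.sum_insert ha, add_comm, h2, ih]
  rw [← h3 Finset.univ]
  congr 1
  funext k
  simp [u, proj, stdVec, Finset.sum_apply]

lemma walk_pair [NeZero N] (ω : Config d N) (φ : (Fin d → ZMod N) → Fin d → ℤ)
    (hcl : ∀ t i j, φ (t + u d N i) j - φ t j = φ (t + u d N j) i - φ t i)
    (hz : ∀ t i, ω (t, i) = true → φ t i = 0) {x y} (h : connected d N ω x y)
    (hxy : proj d N x = proj d N y) : ∑ j, (y j - x j) * ∑ t, φ t j = 0 := by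
  obtain ⟨I, h0, h1, h2⟩ := walk_integral ω φ hcl hz h
  rw [← h2]
  have : ∀ τ, I τ = 0 := fun τ => by
    rw [const_of_inv I _ τ, h0]
    intro τ j
    have := h1 τ j
    rw [hxy] at this
    linarith
  simp [this]

end aux

section planar
variable {N : ℕ}

/-- The edge crossed by a dual edge. -/
def sig (N : ℕ) : Edge 2 N ≃ Edge 2 N where
  toFun e := (e.1 + u 2 N e.2, 1 - e.2)
  invFun e := (e.1 - u 2 N (1 - e.2), 1 - e.2)
  left_inv e := by simp
  right_inv e := by simp

/-- The dual configuration. -/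
def dual (N : ℕ) : Config 2 N ≃ Config 2 N where
  toFun ω e := ! ω (sig N e)
  invFun ω e := ! ω ((sig N).symm e)
  left_inv ω := by funext e; simp
  right_inv ω := by funext e; simp

lemma dual_chain [NeZero N] (ω : Config 2 N) {y y'} (h : connected 2 N (dual N ω) y y') :
    ∃ φ : (Fin 2 → ZMod N) → Fin 2 → ℤ, (∀ t i, ω (t, i) = true → φ t i = 0) ∧
      (∀ t, φ t 0 + φ (t + u 2 N 0) 1 - φ t 1 - φ (t + u 2 N 1) 0 =
        (if t = proj 2 N y then 1 else 0) - (if t = proj 2 N y' then 1 else 0)) ∧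
      ∑ t, φ t 0 = -(y' 1 - y 1) ∧ ∑ t, φ t 1 = y' 0 - y 0 := by
  induction h with
  | refl => exact ⟨0, by simp⟩
  | @tail y' z _ hs ih =>
    obtain ⟨φ, h0, h1, h2, h3⟩ := ih
    -- one elementary step from `a` to `a + e i`
    have elem : ∀ (a : Fin 2 → ℤ) (i : Fin 2), liftOpen 2 N (dual N ω) a i →
        ∃ ψ : (Fin 2 → ZMod N) → Fin 2 → ℤ, (∀ t i, ω (t, i) = true → ψ t i = 0) ∧
        (∀ t, ψ t 0 + ψ (t + u 2 N 0) 1 - ψ t 1 - ψ (t + u 2 N 1) 0 =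
        (if t = proj 2 N a then 1 else 0) - (if t = proj 2 N (a + stdVec 2 i) then 1 else 0)) ∧
        ∑ t, ψ t 0 = -(stdVec 2 i 1) ∧ ∑ t, ψ t 1 = stdVec 2 i 0 := by
      intro a i ho
      have hp : proj 2 N (a + stdVec 2 i) = proj 2 N a + u 2 N i := by rw [proj_add, u]
      rw [hp]
      have ho' : ω (proj 2 N a + u 2 N i, 1 - i) = false := by
        simpa [liftOpen, dual, sig] using ho
      fin_cases i
      · refine ⟨fun t k => if k = 1 ∧ t = proj 2 N a + u 2 N 0 then 1 else 0, ?_, ?_, ?_, ?_⟩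
        · intro t k hk
          simp only [ite_eq_right_iff]
          rintro ⟨rfl, rfl⟩
          simp_all
        · intro t; simp
        · simp [stdVec]
        · simp [stdVec]
      · refine ⟨fun t k => if k = 0 ∧ t = proj 2 N a + u 2 N 1 then -1 else 0, ?_, ?_, ?_, ?_⟩
        · intro t k hk
          simp only [ite_eq_right_iff]
          rintro ⟨rfl, rfl⟩
          simp_all
        · intro t; simp; split_ifs <;> simp
        · simp [stdVec]
        · simp [stdVec]
    rcases hs with ⟨i, rfl, ho⟩ | ⟨i, rfl, ho⟩
    · obtain ⟨ψ, k0, k1, k2, k3⟩ := elem _ i ho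
      refine ⟨fun t k => φ t k + ψ t k, ?_, ?_, ?_, ?_⟩
      · intro t k hk; simp [h0 t k hk, k0 t k hk]
      · intro t; have := h1 t; have := k1 t; linarith
      · rw [Finset.sum_add_distrib, h2, k2]; simp only [Pi.add_apply]; ring
      · rw [Finset.sum_add_distrib, h3, k3]; simp only [Pi.add_apply]; ring
    · obtain ⟨ψ, k0, k1, k2, k3⟩ := elem _ i ho
      refine ⟨fun t k => φ t k - ψ t k, ?_, ?_, ?_, ?_⟩
      · intro t k hk; simp [h0 t k hk, k0 t k hk]
      · intro t; have := h1 t; have := k1 t; linarith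
      · rw [Finset.sum_sub_distrib, h2, k2]; simp only [Pi.add_apply]; ring
      · rw [Finset.sum_sub_distrib, h3, k3]; simp only [Pi.add_apply]; ring

lemma not_span_of_giant [NeZero N] (ω : Config 2 N) (h : ω ∈ giantEvent 2 N) :
    dual N ω ∉ spanEvent 2 N := by
  obtain ⟨x, y, hne, hp, hc⟩ := h
  intro hsp
  have hN : (N : ℤ) ≠ 0 := by exact_mod_cast NeZero.ne N
  obtain ⟨w, rfl⟩ := proj_eq hp
  have hdet : ∀ w' ∈ winding 2 N (dual N ω), w 1 * w' 0 - w 0 * w' 1 = 0 := by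
    rintro w' ⟨b, hb⟩
    obtain ⟨φ, h0, h1, h2, h3⟩ := dual_chain ω hb
    have hcl : ∀ t i j, φ (t + u 2 N i) j - φ t j = φ (t + u 2 N j) i - φ t i := by
      intro t i j
      have := h1 t
      rw [proj_add, proj_smul, add_zero, sub_self] at this
      fin_cases i <;> fin_cases j <;> simp <;> linarith
    have := walk_pair ω φ hcl h0 hc hp
    simp only [Fin.sum_univ_two, h2, h3, Pi.add_apply, Pi.smul_apply, smul_eq_mul] at this
    have h4 : (N : ℤ) * N * (w 1 * w' 0 - w 0 * w' 1) = 0 := by linear_combination this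
    exact (mul_eq_zero.1 h4).resolve_left (mul_ne_zero hN hN)
  let f : (Fin 2 → ℚ) →ₗ[ℚ] ℚ := (w 1 : ℚ) • LinearMap.proj 0 - (w 0 : ℚ) • LinearMap.proj 1
  have hle : Submodule.span ℚ (windingQ 2 N (dual N ω)) ≤ LinearMap.ker f := by
    rw [Submodule.span_le]
    rintro _ ⟨w', hw', rfl⟩
    have := hdet w' hw'
    simp only [SetLike.mem_coe, LinearMap.mem_ker, f]
    simp
    exact_mod_cast this
  rw [show Submodule.span ℚ (windingQ 2 N (dual N ω)) = ⊤ from hsp] at hle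
  have hf : ∀ v, f v = 0 := fun v => hle (Submodule.mem_top)
  have e0 := hf ![1, 0]
  have e1 := hf ![0, 1]
  simp [f] at e0 e1
  apply hne
  have : w = 0 := by
    funext i; fin_cases i
    · exact e1
    · exact e0
  simp [this]

lemma span_of_not_giant [NeZero N] (ω : Config 2 N) (h : ω ∉ giantEvent 2 N) :
    dual N ω ∈ spanEvent 2 N := by
  by_contra hsp
  have hN : (N : ℤ) ≠ 0 := by exact_mod_cast NeZero.ne N
  obtain ⟨f, hf0, hf⟩ := Submodule.exists_le_ker_of_lt_top _ (lt_top_iff_ne_top.2 hsp)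
  let c : (Fin 2 → ℤ) →+ (Fin 2 → ℚ) :=
    { toFun := fun w i => (w i : ℚ)
      map_zero' := by funext i; simp
      map_add' := by intro a b; funext i; simp }
  have hw0 : ∀ w ∈ winding 2 N ω, (N : ℤ) • w = 0 := by
    rintro w ⟨x, hx⟩
    by_contra hne
    exact h ⟨x, _, by simpa using hne, by rw [proj_add, proj_smul, add_zero], hx⟩
  obtain ⟨s, hs⟩ := exists_section ω c (fun w hw => by rw [hw0 w hw, map_zero])
  obtain ⟨g, hg⟩ := exists_section (dual N ω) (f.toAddMonoidHom.comp c) (by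
    intro w hw
    have : f (c w) = 0 := hf (Submodule.subset_span ⟨w, hw, rfl⟩)
    rw [map_zsmul]
    change _ • f (c w) = 0
    rw [this, smul_zero])
  set L : Fin 2 → ℚ := fun i => f (c (stdVec 2 i)) with hLdef
  have hg' : ∀ t i, ω (t + u 2 N i, 1 - i) = false → g (t + u 2 N i) - g t - L i = 0 := by
    intro t i ho
    have := hg t i (by simpa [dual, sig] using ho)
    rw [this]
    simp [hLdef]
  -- the primal chain
  have supp : ∀ t i k, (g (t + u 2 N i) - g t - L i) *
      (s (t + u 2 N i + u 2 N (1 - i)) k - s (t + u 2 N i) k) =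
      (g (t + u 2 N i) - g t - L i) * c (stdVec 2 (1 - i)) k := by
    intro t i k
    rcases ho : ω (t + u 2 N i, 1 - i) with _ | _
    · rw [hg' t i ho]; simp
    · rw [hs _ _ ho]; simp
  have tr : ∀ (F : (Fin 2 → ZMod N) → ℚ) a, ∑ t, F (t + a) = ∑ t, F t := fun F a =>
    Fintype.sum_equiv (Equiv.addRight a) _ _ (fun _ => rfl)
  have main : ∀ k, ∑ t, (g (t + u 2 N 0) - g t - L 0) * c (stdVec 2 1) k =
      ∑ t, (g (t + u 2 N 1) - g t - L 1) * c (stdVec 2 0) k := by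
    intro k
    have A := Finset.sum_congr rfl fun t (_ : t ∈ Finset.univ) => supp t 0 k
    have B := Finset.sum_congr rfl fun t (_ : t ∈ Finset.univ) => supp t 1 k
    simp only [sub_zero, sub_self] at A B
    rw [← A, ← B]
    have c1 := tr (fun t => s t k) (u 2 N 0)
    have c2 := tr (fun t => s t k) (u 2 N 1)
    have c3 := tr (fun t => g t * s t k) (u 2 N 0)
    have c4 := tr (fun t => g t * s t k) (u 2 N 1)
    have c5 := tr (fun t => g t * s (t + u 2 N 1) k) (u 2 N 0)
    have c6 := tr (fun t => g t * s (t + u 2 N 0) k) (u 2 N 1)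
    have c7 : ∀ t, s (t + u 2 N 1 + u 2 N 0) k = s (t + u 2 N 0 + u 2 N 1) k := fun t => by
      rw [add_right_comm]
    simp only [c7] at c6 ⊢
    simp only [sub_mul, mul_sub, Finset.sum_sub_distrib, ← Finset.mul_sum]
    have c8 := tr (fun t => s (t + u 2 N 1) k) (u 2 N 0)
    rw [c3, c4, c5, c6, c8, c2, c1]
    ring
  have hcard : ((Fintype.card (Fin 2 → ZMod N) : ℕ) : ℚ) ≠ 0 := by
    exact_mod_cast Fintype.card_ne_zero
  have z : ∀ i, ∑ t, (g (t + u 2 N i) - g t - L i) =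
      - (Fintype.card (Fin 2 → ZMod N) : ℚ) * L i := by
    intro i
    rw [Finset.sum_sub_distrib, Finset.sum_sub_distrib, tr]
    simp
  have hc : ∀ i k, c (stdVec 2 i) k = if k = i then 1 else 0 := by
    intro i k; simp [c, stdVec]
  have L0 : L 0 = 0 := by
    have := main 1
    simp only [← Finset.sum_mul, z, hc] at this
    simpa [NeZero.ne N] using this
  have L1 : L 1 = 0 := by
    have := main 0
    simp only [← Finset.sum_mul, z, hc] at this
    simpa [NeZero.ne N] using this
  apply hf0
  apply LinearMap.pi_ext'
  intro i
  ext
  have hcs : c (stdVec 2 i) = Pi.single i 1 := by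
    funext k; rw [hc]; simp [Pi.single_apply]
  have : L i = 0 := by fin_cases i; exacts [L0, L1]
  rw [hLdef] at this
  simp only [hcs] at this
  simpa using this

lemma giant_iff [NeZero N] (ω : Config 2 N) :
    ω ∈ giantEvent 2 N ↔ dual N ω ∉ spanEvent 2 N :=
  ⟨not_span_of_giant ω, fun h => by_contra fun h' => h (span_of_not_giant ω h')⟩

/-- weight of a configuration -/
noncomputable def wt (N : ℕ) [NeZero N] (p : ℝ) (ω : Config 2 N) : ℝ :=
  ∏ e : Edge 2 N, (if ω e then p else 1 - p)

open Classical in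
lemma prob_eq [NeZero N] (p : ℝ) (S : Set (Config 2 N)) :
    prob 2 N p S = ∑ ω : Config 2 N, if ω ∈ S then wt N p ω else 0 := by
  rw [prob, finsum_mem_def, finsum_eq_sum_of_fintype]
  refine Finset.sum_congr rfl fun ω _ => ?_
  rw [Set.indicator_apply, finprod_eq_prod_of_fintype, wt]

lemma wt_dual [NeZero N] (p : ℝ) (ω : Config 2 N) : wt N (1 - p) (dual N ω) = wt N p ω := by
  unfold wt
  refine Fintype.prod_equiv (sig N) _ _ fun e => ?_
  simp only [dual, Equiv.coe_fn_mk]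
  by_cases h : ω (sig N e) = true <;> simp [h]

lemma wt_sum [NeZero N] (p : ℝ) : ∑ ω : Config 2 N, wt N p ω = 1 := by
  unfold wt
  rw [← Fintype.prod_sum (fun (_ : Edge 2 N) (b : Bool) => if b then p else 1 - p)]
  simp

end planar
end TorusPerc

/-- For bond percolation on the two-dimensional torus `T²_N`, for every `N ≥ 1` and
every `p ∈ [0,1]`, `ℙ_p(A^□) = 1 − ℙ_{1−p}(S^□)`. -/
theorem torus2_giant_eq_one_sub_dual_span (N : ℕ) (hN : 1 ≤ N) (p : ℝ)
    (hp : p ∈ Set.Icc (0 : ℝ) 1) :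
    TorusPerc.prob 2 N p (TorusPerc.giantEvent 2 N) =
      1 - TorusPerc.prob 2 N (1 - p) (TorusPerc.spanEvent 2 N) := by
  classical
  have : NeZero N := ⟨by omega⟩
  have h1 := TorusPerc.wt_sum (N := N) (1 - p)
  rw [TorusPerc.prob_eq, TorusPerc.prob_eq]
  conv_rhs => arg 1; rw [← h1]
  rw [← Finset.sum_sub_distrib]
  refine Fintype.sum_equiv (TorusPerc.dual N) _ _ fun ω => ?_
  rw [TorusPerc.wt_dual]
  by_cases h : TorusPerc.dual N ω ∈ TorusPerc.spanEvent 2 N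
  · simp [h, TorusPerc.giant_iff]
  · simp [h, TorusPerc.giant_iff]
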